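/- arXiv:2403.06718 — 4 statements merged into one kernel-verified Lean document; each statement's English description precedes it below -/
import Mathlib

section
/- Let (Z₁,Z₂) be a random vector with the bivariate Pareto type II density g_{m,h₁,h₂} for parameters m > 1 and h₁, h₂ > 0. Then the conditional expectation of Z₂ given Z₁ is E(Z₂ | Z₁) = (1 + h₁Z₁)/(h₂ m) almost surely; in particular the regression of Z₂ on Z₁ is affine linear in Z₁. -/
open MeasureTheory ProbabilityTheory Real

/-- Bivariate Pareto type II density on `(0,∞)²` with shape `m` and parameters `h₁, h₂`:
`g(z₁,z₂) = (Γ(m+2)/Γ(m)) h₁ h₂ (1 + h₁z₁ + h₂z₂)^{-(m+2)}` (note `(m)₂ = Γ(m+2)/Γ(m)`). -/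
noncomputable def bivParetoPDF (m h₁ h₂ : ℝ) (z : ℝ × ℝ) : ℝ :=
  if 0 < z.1 ∧ 0 < z.2 then
    (Real.Gamma (m + 2) / Real.Gamma m) * (h₁ * h₂) * (1 + h₁ * z.1 + h₂ * z.2) ^ (-(m + 2))
  else 0

/-- For `0 < a`, `0 < h` and `0 < s`, the power `(a + h y)^(-(s+1))` is integrable on `(0,∞)` with
integral `a^(-s) / (h s)`. -/
lemma integral_Ioi_affine_rpow {a h s : ℝ} (ha : 0 < a) (hh : 0 < h) (hs : 0 < s) :
    IntegrableOn (fun y : ℝ => (a + h * y) ^ (-(s + 1))) (Set.Ioi 0) ∧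
      ∫ y in Set.Ioi (0 : ℝ), (a + h * y) ^ (-(s + 1)) = a ^ (-s) / (h * s) := by
  have hd : ∀ y ∈ Set.Ici (0 : ℝ),
      HasDerivAt (fun y : ℝ => -((a + h * y) ^ (-s) / (h * s))) ((a + h * y) ^ (-(s + 1))) y := by
    intro y hy
    have hu : 0 < a + h * y := by have := mul_nonneg hh.le (Set.mem_Ici.1 hy); linarith
    have h1 : HasDerivAt (fun y : ℝ => a + h * y) h y := by
      simpa using ((hasDerivAt_id y).const_mul h).const_add a
    refine ((h1.rpow_const (p := -s) (Or.inl hu.ne')).div_const (h * s)).neg.congr_deriv ?_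
    rw [show -(s + 1) = -s - 1 by ring]
    field_simp
  have hpos : ∀ y ∈ Set.Ioi (0 : ℝ), 0 ≤ (a + h * y) ^ (-(s + 1)) := by
    intro y hy
    have := mul_pos hh (Set.mem_Ioi.1 hy)
    positivity
  have hlim : Filter.Tendsto (fun y : ℝ => -((a + h * y) ^ (-s) / (h * s))) Filter.atTop
      (nhds 0) := by
    have h1 : Filter.Tendsto (fun y : ℝ => a + h * y) Filter.atTop Filter.atTop :=
      Filter.tendsto_atTop_add_const_left _ _ (Filter.tendsto_id.const_mul_atTop hh)
    simpa using (((tendsto_rpow_neg_atTop hs).comp h1).div_const (h * s)).neg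
  refine ⟨integrableOn_Ioi_deriv_of_nonneg' hd hpos hlim, ?_⟩
  rw [integral_Ioi_of_hasDerivAt_of_nonneg' hd hpos hlim]
  simp

/-- The first moment of the affine power `(a + h y)^(-(m+2))` on `(0,∞)` is `a / (h m)` times its
mass. -/
lemma integral_Ioi_mul_affine_rpow {a h m : ℝ} (ha : 0 < a) (hh : 0 < h) (hm : 0 < m) :
    IntegrableOn (fun y : ℝ => (a + h * y) ^ (-(m + 2)) * y) (Set.Ioi 0) ∧
      ∫ y in Set.Ioi (0 : ℝ), (a + h * y) ^ (-(m + 2)) * y = a ^ (-m) / (h ^ 2 * m * (m + 1)) := by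
  obtain ⟨i1, e1⟩ := integral_Ioi_affine_rpow ha hh hm
  obtain ⟨i2, e2⟩ := integral_Ioi_affine_rpow ha hh (show 0 < m + 1 by linarith)
  have heq : Set.EqOn (fun y : ℝ => ((a + h * y) ^ (-(m + 1)) - a * (a + h * y) ^ (-(m + 1 + 1))) / h)
      (fun y : ℝ => (a + h * y) ^ (-(m + 2)) * y) (Set.Ioi 0) := by
    intro y hy
    have hu : 0 < a + h * y := by have := mul_pos hh (Set.mem_Ioi.1 hy); linarith
    dsimp only
    rw [show -(m + 1) = -(m + 2) + 1 by ring, rpow_add_one hu.ne',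
      show -(m + 1 + 1) = -(m + 2) by ring]
    field_simp
    ring
  refine ⟨IntegrableOn.congr_fun ((i1.sub (i2.const_mul a)).div_const h) heq measurableSet_Ioi, ?_⟩
  rw [← setIntegral_congr_fun measurableSet_Ioi heq, integral_div,
    integral_sub i1 (i2.const_mul a), integral_const_mul, e1, e2,
    show -m = -(m + 1) + 1 by ring, rpow_add_one ha.ne']
  field_simp
  ring

lemma measurable_bivParetoPDF (m h₁ h₂ : ℝ) : Measurable (bivParetoPDF m h₁ h₂) := by
  unfold bivParetoPDF
  refine Measurable.ite ?_ (by fun_prop) measurable_const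
  exact (measurableSet_lt measurable_const measurable_fst).inter
    (measurableSet_lt measurable_const measurable_snd)

lemma bivParetoPDF_of_nonpos_left (m h₁ h₂ : ℝ) {x : ℝ} (hx : x ≤ 0) (y : ℝ) :
    bivParetoPDF m h₁ h₂ (x, y) = 0 := by
  simp [bivParetoPDF, hx.not_gt]

/-- For fixed `x > 0`, an integral against the section of the density reduces to `(0,∞)`. -/
lemma lintegral_bivParetoPDF_section {m h₁ h₂ x : ℝ} (hx : 0 < x) (g : ℝ → ENNReal) :
    ∫⁻ y, ENNReal.ofReal (bivParetoPDF m h₁ h₂ (x, y)) * g y =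
      ∫⁻ y in Set.Ioi 0, ENNReal.ofReal (Real.Gamma (m + 2) / Real.Gamma m * (h₁ * h₂) *
        (1 + h₁ * x + h₂ * y) ^ (-(m + 2))) * g y := by
  rw [← lintegral_indicator measurableSet_Ioi]
  congr 1 with y
  by_cases hy : 0 < y <;> simp [bivParetoPDF, hx, hy]


lemma lintegral_bivParetoPDF_section_mul_snd {m h₁ h₂ x : ℝ} (hm : 0 < m) (hh₁ : 0 < h₁)
    (hh₂ : 0 < h₂) (hx : 0 < x) :
    ∫⁻ y, ENNReal.ofReal (bivParetoPDF m h₁ h₂ (x, y)) * ENNReal.ofReal y =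
      ENNReal.ofReal (Real.Gamma (m + 2) / Real.Gamma m * (h₁ * h₂) *
        ((1 + h₁ * x) ^ (-m) / (h₂ ^ 2 * m * (m + 1)))) := by
  have ha : 0 < 1 + h₁ * x := by positivity
  have hC : 0 < Real.Gamma (m + 2) / Real.Gamma m * (h₁ * h₂) := by
    have := Real.Gamma_pos_of_pos hm
    have := Real.Gamma_pos_of_pos (show 0 < m + 2 by linarith)
    positivity
  obtain ⟨i, e⟩ := integral_Ioi_mul_affine_rpow ha hh₂ hm
  rw [lintegral_bivParetoPDF_section hx, ← e, ← integral_const_mul,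
    ofReal_integral_eq_lintegral_ofReal (i.const_mul _)]
  · refine setLIntegral_congr_fun measurableSet_Ioi fun y hy => ?_
    have hy : 0 < y := hy
    rw [← ENNReal.ofReal_mul (by positivity), mul_assoc]
  · filter_upwards [ae_restrict_mem measurableSet_Ioi] with y hy
    have hy : 0 < y := hy
    simp only [Pi.zero_apply]
    positivity

lemma lintegral_bivParetoPDF_section_eq {m h₁ h₂ x : ℝ} (hm : 0 < m) (hh₁ : 0 < h₁)
    (hh₂ : 0 < h₂) (hx : 0 < x) :
    ∫⁻ y, ENNReal.ofReal (bivParetoPDF m h₁ h₂ (x, y)) =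
      ENNReal.ofReal (Real.Gamma (m + 2) / Real.Gamma m * (h₁ * h₂) *
        ((1 + h₁ * x) ^ (-(m + 1)) / (h₂ * (m + 1)))) := by
  have ha : 0 < 1 + h₁ * x := by positivity
  have hC : 0 < Real.Gamma (m + 2) / Real.Gamma m * (h₁ * h₂) := by
    have := Real.Gamma_pos_of_pos hm
    have := Real.Gamma_pos_of_pos (show 0 < m + 2 by linarith)
    positivity
  obtain ⟨i, e⟩ := integral_Ioi_affine_rpow ha hh₂ (show 0 < m + 1 by linarith)
  have h := lintegral_bivParetoPDF_section (m := m) (h₁ := h₁) (h₂ := h₂) hx (fun _ => 1)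
  simp only [mul_one] at h
  rw [h, ← e, ← integral_const_mul, ofReal_integral_eq_lintegral_ofReal (i.const_mul _),
    show m + 1 + 1 = m + 2 by ring]
  filter_upwards [ae_restrict_mem measurableSet_Ioi] with y hy
  have hy : 0 < y := hy
  simp only [Pi.zero_apply]
  positivity

/-- Conditionally on the first coordinate, the second one has mean `(1 + h₁ x) / (h₂ m)`. -/
lemma lintegral_bivParetoPDF_section_mul_snd_eq {m h₁ h₂ : ℝ} (hm : 0 < m) (hh₁ : 0 < h₁)
    (hh₂ : 0 < h₂) (x : ℝ) :
    ∫⁻ y, ENNReal.ofReal (bivParetoPDF m h₁ h₂ (x, y)) * ENNReal.ofReal y =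
      ∫⁻ y, ENNReal.ofReal (bivParetoPDF m h₁ h₂ (x, y)) *
        ENNReal.ofReal ((1 + h₁ * x) / (h₂ * m)) := by
  rcases le_or_gt x 0 with hx | hx
  · simp [bivParetoPDF_of_nonpos_left m h₁ h₂ hx]
  have ha : 0 < 1 + h₁ * x := by positivity
  rw [lintegral_mul_const' _ _ ENNReal.ofReal_ne_top,
    lintegral_bivParetoPDF_section_mul_snd hm hh₁ hh₂ hx,
    lintegral_bivParetoPDF_section_eq hm hh₁ hh₂ hx, ← ENNReal.ofReal_mul' (by positivity)]
  congr 1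
  rw [show -m = -(m + 1) + 1 by ring, Real.rpow_add_one ha.ne']
  field_simp

lemma setLIntegral_fst_preimage_withDensity {f g : ℝ × ℝ → ENNReal} (hf : Measurable f)
    (hg : Measurable g) {s : Set ℝ} (hs : MeasurableSet s) :
    ∫⁻ z in Prod.fst ⁻¹' s, g z ∂(volume.withDensity f) =
      ∫⁻ x in s, ∫⁻ y, f (x, y) * g (x, y) := by
  rw [setLIntegral_withDensity_eq_setLIntegral_mul _ hf hg (measurable_fst hs),
    ← Set.prod_univ, Measure.volume_eq_prod, ← Measure.prod_restrict, Measure.restrict_univ,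
    lintegral_prod _ (hf.mul hg).aemeasurable]
  rfl

/-- The second coordinate of a bivariate Pareto vector with shape `m > 1` has finite mean. -/
lemma lintegral_snd_bivPareto_lt_top {m h₁ h₂ : ℝ} (hm : 1 < m) (hh₁ : 0 < h₁) (hh₂ : 0 < h₂) :
    ∫⁻ z, ENNReal.ofReal z.2
      ∂(volume.withDensity fun z => ENNReal.ofReal (bivParetoPDF m h₁ h₂ z)) < ⊤ := by
  have h := setLIntegral_fst_preimage_withDensity (measurable_bivParetoPDF m h₁ h₂).ennreal_ofReal
    measurable_snd.ennreal_ofReal MeasurableSet.univ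
  simp only [Set.preimage_univ, Measure.restrict_univ] at h
  obtain ⟨i, -⟩ := integral_Ioi_affine_rpow one_pos hh₁ (sub_pos.2 hm)
  rw [sub_add_cancel] at i
  rw [h, ← setLIntegral_eq_of_support_subset (s := Set.Ioi 0)]
  · rw [setLIntegral_congr_fun measurableSet_Ioi fun x hx =>
      lintegral_bivParetoPDF_section_mul_snd (one_pos.trans hm) hh₁ hh₂ hx]
    exact ((i.div_const _).const_mul _).lintegral_lt_top
  · intro x hx
    by_contra hx0
    exact hx (by simp [bivParetoPDF_of_nonpos_left m h₁ h₂ (not_lt.1 hx0)])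

/-- If `(Z₁, Z₂)` has the bivariate Pareto type II density `g_{m,h₁,h₂}` with `m > 1`,
`h₁, h₂ > 0`, then `E(Z₂ | Z₁) = (1 + h₁ Z₁)/(h₂ m)` almost surely: the regression of
`Z₂` on `Z₁` is affine linear in `Z₁`. -/
theorem bivPareto_conditional_expectation
    {Ω : Type*} [MeasurableSpace Ω] (μ : Measure Ω) [IsProbabilityMeasure μ]
    (m h₁ h₂ : ℝ) (hm : 1 < m) (hh₁ : 0 < h₁) (hh₂ : 0 < h₂)
    (Z₁ Z₂ : Ω → ℝ) (hZmeas : Measurable fun ω => (Z₁ ω, Z₂ ω))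
    (hZ : Measure.map (fun ω => (Z₁ ω, Z₂ ω)) μ =
      volume.withDensity (fun z => ENNReal.ofReal (bivParetoPDF m h₁ h₂ z))) :
    μ[Z₂ | MeasurableSpace.comap Z₁ Real.measurableSpace] =ᵐ[μ]
      fun ω => (1 + h₁ * Z₁ ω) / (h₂ * m) := by
  have hm0 : 0 < m := one_pos.trans hm
  have hZ₁ : Measurable Z₁ := hZmeas.fst
  have hZ₂ : Measurable Z₂ := hZmeas.snd
  have hpdf := (measurable_bivParetoPDF m h₁ h₂).ennreal_ofReal
  have hpos : ∀ᵐ ω ∂μ, 0 < Z₁ ω ∧ 0 < Z₂ ω := by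
    refine ae_of_ae_map (p := fun z : ℝ × ℝ => 0 < z.1 ∧ 0 < z.2) hZmeas.aemeasurable ?_
    rw [hZ, ae_withDensity_iff hpdf]
    refine .of_forall fun z hz => ?_
    by_contra hneg
    exact hz (by simp [bivParetoPDF, hneg])
  have hnn₂ : 0 ≤ᵐ[μ] Z₂ := hpos.mono fun ω h => h.2.le
  have hnn : 0 ≤ᵐ[μ] fun ω => (1 + h₁ * Z₁ ω) / (h₂ * m) := by
    filter_upwards [hpos] with ω h
    have := h.1
    simp only [Pi.zero_apply]
    positivity
  have hreg : Measurable fun ω => (1 + h₁ * Z₁ ω) / (h₂ * m) := by fun_prop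
  have heq : ∀ s : Set ℝ, MeasurableSet s →
      ∫⁻ ω in Z₁ ⁻¹' s, ENNReal.ofReal (Z₂ ω) ∂μ =
        ∫⁻ ω in Z₁ ⁻¹' s, ENNReal.ofReal ((1 + h₁ * Z₁ ω) / (h₂ * m)) ∂μ := by
    intro s hs
    have hg : Measurable fun z : ℝ × ℝ => ENNReal.ofReal ((1 + h₁ * z.1) / (h₂ * m)) := by
      fun_prop
    have e₁ := setLIntegral_map (μ := μ) (measurable_fst hs) measurable_snd.ennreal_ofReal hZmeas
    have e₂ := setLIntegral_map (μ := μ) (measurable_fst hs) hg hZmeas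
    rw [hZ, setLIntegral_fst_preimage_withDensity hpdf measurable_snd.ennreal_ofReal hs] at e₁
    rw [hZ, setLIntegral_fst_preimage_withDensity hpdf hg hs] at e₂
    refine e₁.symm.trans (.trans ?_ e₂)
    simp only [lintegral_bivParetoPDF_section_mul_snd_eq hm0 hh₁ hh₂]
  have hfin : ∫⁻ ω, ENNReal.ofReal (Z₂ ω) ∂μ < ⊤ := by
    have h := lintegral_snd_bivPareto_lt_top hm hh₁ hh₂
    rwa [← hZ, lintegral_map measurable_snd.ennreal_ofReal hZmeas] at h
  have hint₂ : Integrable Z₂ μ :=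
    ⟨hZ₂.aestronglyMeasurable, (hasFiniteIntegral_iff_ofReal hnn₂).2 hfin⟩
  have hint : Integrable (fun ω => (1 + h₁ * Z₁ ω) / (h₂ * m)) μ := by
    refine ⟨hreg.aestronglyMeasurable, (hasFiniteIntegral_iff_ofReal hnn).2 ?_⟩
    have h := heq Set.univ .univ
    simp only [Set.preimage_univ, Measure.restrict_univ] at h
    rwa [← h]
  symm
  refine ae_eq_condExp_of_forall_setIntegral_eq hZ₁.comap_le hint₂
    (fun s _ _ => hint.integrableOn) ?_ ?_
  · rintro _ ⟨s, hs, rfl⟩ -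
    rw [integral_eq_lintegral_of_nonneg_ae (ae_restrict_of_ae hnn) hreg.aestronglyMeasurable,
      integral_eq_lintegral_of_nonneg_ae (ae_restrict_of_ae hnn₂) hZ₂.aestronglyMeasurable,
      heq s hs]
  · have h : Measurable[MeasurableSpace.comap Z₁ Real.measurableSpace] Z₁ :=
      comap_measurable Z₁
    exact (((h.const_mul h₁).const_add 1).div_const (h₂ * m)).aestronglyMeasurable
end

section
/- Let Z = (Z₁,…,Z_N) be a random vector with the multivariate Pareto type II density g_{m,h₁,…,h_N} for parameters m, h₁,…,h_N > 0, and set W = Σ_{i=1}^N h_i Z_i. Then W has the Beta type II density f_W(w) = [Γ(N+m)/(Γ(N)Γ(m))] · w^{N−1}/(1+w)^{N+m} for w ∈ (0,∞). -/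
open MeasureTheory ProbabilityTheory Real

/-- Multivariate Pareto type II density on `(0,∞)^N` with shape `m > 0` and
parameters `h i > 0`: `g(z) = (Γ(m+N)/Γ(m)) (∏ h i) (1 + Σ h i z i)^{-(m+N)}`. -/
noncomputable def mvParetoPDF {N : ℕ} (m : ℝ) (h : Fin N → ℝ) (z : Fin N → ℝ) : ℝ :=
  if ∀ i, 0 < z i then
    (Real.Gamma (m + N) / Real.Gamma m) * (∏ i, h i) *
      (1 + ∑ i, h i * z i) ^ (-(m + (N : ℝ)))
  else 0

/-- The Beta type II density of `B2(N, m)`: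
`f(w) = Γ(N+m)/(Γ(N)Γ(m)) · w^{N-1}/(1+w)^{N+m}` on `(0,∞)`. -/
noncomputable def betaTypeIIPDF (N m w : ℝ) : ℝ :=
  if 0 < w then
    Real.Gamma (N + m) / (Real.Gamma N * Real.Gamma m) * (w ^ (N - 1) / (1 + w) ^ (N + m))
  else 0

lemma lintegral_Ioo_sub_pow_div_factorial (n : ℕ) (t : ℝ) (ht : 0 < t) :
    ∫⁻ x in Set.Ioo 0 t, ENNReal.ofReal ((t - x) ^ n / n.factorial) =
      ENNReal.ofReal (t ^ (n + 1) / (n + 1).factorial) := by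
  rw [← ofReal_integral_eq_lintegral_ofReal]
  · congr 1
    rw [← integral_Ioc_eq_integral_Ioo, ← intervalIntegral.integral_of_le ht.le,
      intervalIntegral.integral_div,
      intervalIntegral.integral_comp_sub_left (fun x => x ^ n) t, integral_pow]
    rw [Nat.factorial_succ]
    push_cast
    simp
    field_simp
  · exact ((by fun_prop : Continuous fun x : ℝ => (t - x) ^ n / n.factorial).integrableOn_Icc).mono_set
      Set.Ioo_subset_Icc_self
  · filter_upwards [ae_restrict_mem measurableSet_Ioo] with x hx
    have : 0 ≤ t - x := by linarith [hx.2]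
    positivity

lemma lintegral_Ioi_lintegral_Ioi_pow_mul_add (n : ℕ) {f : ℝ → ENNReal} (hf : Measurable f) :
    ∫⁻ x in Set.Ioi (0 : ℝ), ∫⁻ s in Set.Ioi (0 : ℝ),
        ENNReal.ofReal (s ^ n / n.factorial) * f (x + s) =
      ∫⁻ t in Set.Ioi (0 : ℝ), ENNReal.ofReal (t ^ (n + 1) / (n + 1).factorial) * f t := by
  have shift (x : ℝ) : ∫⁻ s in Set.Ioi (0 : ℝ), ENNReal.ofReal (s ^ n / n.factorial) * f (x + s) =
      ∫⁻ t, (Set.Ioi (0 : ℝ)).indicator (fun s => ENNReal.ofReal (s ^ n / n.factorial)) (t - x) *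
        f t := by
    rw [← lintegral_indicator measurableSet_Ioi, ← lintegral_sub_right_eq_self _ x]
    congr 1 with t
    by_cases ht : t - x ∈ Set.Ioi (0 : ℝ) <;> simp [ht]
  have hg : Measurable
      ((Set.Ioi (0 : ℝ)).indicator (fun s => ENNReal.ofReal (s ^ n / n.factorial))) :=
    Measurable.indicator (by fun_prop) measurableSet_Ioi
  simp_rw [shift]
  rw [lintegral_lintegral_swap (by fun_prop), ← lintegral_indicator measurableSet_Ioi]
  congr 1 with t
  rw [lintegral_mul_const _ (by fun_prop), ← lintegral_indicator measurableSet_Ioi]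
  have hind : (Set.Ioi (0 : ℝ)).indicator (fun x => (Set.Ioi (0 : ℝ)).indicator
      (fun s => ENNReal.ofReal (s ^ n / n.factorial)) (t - x)) =
      (Set.Ioo 0 t).indicator (fun x => ENNReal.ofReal ((t - x) ^ n / n.factorial)) := by
    ext x
    by_cases h₁ : 0 < x <;> by_cases h₂ : x < t <;> simp [Set.indicator, h₁, h₂]
  rw [hind, lintegral_indicator measurableSet_Ioo]
  by_cases ht : 0 < t
  · rw [lintegral_Ioo_sub_pow_div_factorial n t ht, Set.indicator_of_mem (by exact ht)]
  · simp [ht]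

lemma lintegral_pi_Ioi_comp_sum (n : ℕ) {f : ℝ → ENNReal} (hf : Measurable f) :
    ∫⁻ z, f (∑ i, z i) ∂(Measure.pi fun _ : Fin (n + 1) => volume.restrict (Set.Ioi (0 : ℝ))) =
      ∫⁻ t in Set.Ioi (0 : ℝ), ENNReal.ofReal (t ^ n / n.factorial) * f t := by
  induction n generalizing f with
  | zero =>
    have hmp := measurePreserving_funUnique (volume.restrict (Set.Ioi (0 : ℝ))) (Fin 1)
    have := hmp.lintegral_comp hf
    simp only [pow_zero, Nat.factorial_zero, Nat.cast_one, div_one, ENNReal.ofReal_one, one_mul]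
    convert this using 3
    exact congrArg f (Fintype.sum_unique (ι := Fin 1) _)
  | succ n ih =>
    have hmp := measurePreserving_piFinSuccAbove
      (fun _ : Fin (n + 1 + 1) => volume.restrict (Set.Ioi (0 : ℝ))) 0
    have := hmp.lintegral_comp (f := fun p => f (p.1 + ∑ i, p.2 i)) (by fun_prop)
    simp_rw [Fin.sum_univ_succ (n := n + 1)]
    rw [← lintegral_Ioi_lintegral_Ioi_pow_mul_add n hf]
    refine this.trans ?_
    rw [lintegral_prod _ (by fun_prop)]
    refine lintegral_congr fun x => ?_
    exact ih (f := fun s => f (x + s)) (by fun_prop)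

lemma lintegral_pi_eq_prod_mul_lintegral_comp_mul {ι : Type*} [Fintype ι] {h : ι → ℝ}
    (hh : ∀ i, 0 < h i) {F : (ι → ℝ) → ENNReal} (hF : Measurable F) :
    ∫⁻ y, F y = ENNReal.ofReal (∏ i, h i) * ∫⁻ z : ι → ℝ, F (fun i => h i * z i) := by
  classical
  have key := Real.smul_map_diagonal_volume_pi (D := h)
    (by simpa using Finset.prod_ne_zero_iff.2 fun i _ => (hh i).ne')
  rw [Matrix.det_diagonal, abs_of_pos (Finset.prod_pos fun i _ => hh i)] at key
  conv_lhs => rw [← key]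
  rw [lintegral_smul_measure, lintegral_map hF (LinearMap.continuous_of_finiteDimensional _).measurable]
  simp only [smul_eq_mul, Matrix.toLin'_apply]
  congr 1
  refine lintegral_congr fun z => congrArg F ?_
  ext i
  simp [Matrix.mulVec_diagonal]

/-- A weighted sum of positive variables pushes Lebesgue measure on the orthant forward to
a measure with power density. -/
lemma prod_mul_lintegral_orthant_comp_sum_mul (n : ℕ) {h : Fin (n + 1) → ℝ} (hh : ∀ i, 0 < h i)
    {f : ℝ → ENNReal} (hf : Measurable f) :
    ENNReal.ofReal (∏ i, h i) *
        ∫⁻ z in Set.univ.pi fun _ => Set.Ioi (0 : ℝ), f (∑ i, h i * z i) =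
      ∫⁻ t in Set.Ioi (0 : ℝ), ENNReal.ofReal (t ^ n / n.factorial) * f t := by
  have hs : MeasurableSet (Set.univ.pi fun _ : Fin (n + 1) => Set.Ioi (0 : ℝ)) :=
    MeasurableSet.univ_pi fun _ => measurableSet_Ioi
  rw [← lintegral_pi_Ioi_comp_sum n hf, ← Measure.restrict_pi_pi, ← volume_pi,
    ← lintegral_indicator hs, ← lintegral_indicator hs,
    lintegral_pi_eq_prod_mul_lintegral_comp_mul hh
      (F := Set.indicator _ fun z => f (∑ i, z i)) (Measurable.indicator (by fun_prop) hs)]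
  congr 1
  refine lintegral_congr fun z => ?_
  simp [Set.indicator, hh]

/-- If `Z = (Z₁,…,Z_N)` has the multivariate Pareto type II density `g_{m,h₁,…,h_N}`
(`m, hᵢ > 0`), then `W = Σ h_i Z_i` is Beta type II distributed: it has density
`Γ(N+m)/(Γ(N)Γ(m)) · w^{N-1}/(1+w)^{N+m}` on `(0,∞)`. -/
theorem mvPareto_weighted_sum_betaTypeII
    {Ω : Type*} [MeasurableSpace Ω] (μ : Measure Ω) [IsProbabilityMeasure μ]
    (N : ℕ) (hN : 1 ≤ N) (m : ℝ) (hm : 0 < m) (h : Fin N → ℝ) (hh : ∀ i, 0 < h i)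
    (Z : Ω → (Fin N → ℝ)) (hZmeas : Measurable Z)
    (hZ : Measure.map Z μ =
      volume.withDensity (fun z => ENNReal.ofReal (mvParetoPDF m h z))) :
    Measure.map (fun ω => ∑ i, h i * Z ω i) μ =
      volume.withDensity (fun w => ENNReal.ofReal (betaTypeIIPDF (N : ℝ) m w)) := by
  obtain ⟨n, rfl⟩ := Nat.exists_eq_add_of_le' hN
  have hsum : Measurable fun z : Fin (n + 1) → ℝ => ∑ i, h i * z i := by fun_prop
  have hcomp : (fun ω => ∑ i, h i * Z ω i) = (fun z => ∑ i, h i * z i) ∘ Z := rfl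
  rw [hcomp, ← Measure.map_map hsum hZmeas, hZ]
  ext s hs
  set c : ℝ := Real.Gamma (m + (n + 1 : ℕ)) / Real.Gamma m with hc
  have hprod : 0 ≤ ∏ i, h i := Finset.prod_nonneg fun i _ => (hh i).le
  let f : ℝ → ENNReal :=
    s.indicator fun w => ENNReal.ofReal (c * (1 + w) ^ (-(m + ((n + 1 : ℕ) : ℝ))))
  have hf : Measurable f := Measurable.indicator (by fun_prop) hs
  have hO : MeasurableSet (Set.univ.pi fun _ : Fin (n + 1) => Set.Ioi (0 : ℝ)) :=
    MeasurableSet.univ_pi fun _ => measurableSet_Ioi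
  rw [Measure.map_apply hsum hs, withDensity_apply _ (hsum hs), withDensity_apply _ hs,
    ← lintegral_indicator (hsum hs), ← lintegral_indicator hs]
  calc
    _ = ∫⁻ z, ENNReal.ofReal (∏ i, h i) *
        (Set.univ.pi fun _ => Set.Ioi (0 : ℝ)).indicator (fun z => f (∑ i, h i * z i)) z := by
      congr 1 with z
      by_cases hz : ∀ i, 0 < z i <;> by_cases hzs : ∑ i, h i * z i ∈ s <;>
        simp only [Set.indicator, Set.mem_preimage, hzs, mvParetoPDF, hz, f, Set.mem_pi,
          Set.mem_univ, Set.mem_Ioi, if_true, if_false, forall_true_left, mul_zero,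
          ENNReal.ofReal_zero, implies_true]
      rw [← ENNReal.ofReal_mul hprod]
      congr 1
      ring
    _ = ∫⁻ t in Set.Ioi (0 : ℝ), ENNReal.ofReal (t ^ n / n.factorial) * f t := by
      rw [lintegral_const_mul _ (Measurable.indicator (by fun_prop) hO), lintegral_indicator hO,
        prod_mul_lintegral_orthant_comp_sum_mul n hh hf]
    _ = _ := by
      rw [← lintegral_indicator measurableSet_Ioi]
      congr 1 with t
      by_cases ht : 0 < t <;> by_cases hts : t ∈ s <;>
        simp only [Set.indicator, hts, betaTypeIIPDF, ht, f, Set.mem_Ioi, if_true, if_false,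
          mul_zero, ENNReal.ofReal_zero]
      rw [← ENNReal.ofReal_mul (by positivity)]
      congr 1
      rw [hc, Real.rpow_neg (by positivity), Nat.cast_add_one, add_sub_cancel_right,
        Real.rpow_natCast, Real.Gamma_nat_eq_factorial, add_comm m]
      ring
end

section
/- Fix integers 1 ≤ m < n, 1 ≤ N ≤ n−m, reals α, β ≥ 0 with m+α > 0, x > 0 with x+β > 0, and λ ∈ (0,1). Let q̂ be the multivariate Pareto type II density g_{m+α, h₁,…,h_N} with h_i = (n−m−i+1)/(x+β), and let c₀ > 0 be the (1−λ)-quantile of the Beta type II distribution B2(N, m+α). Then the region R = {z ∈ (0,∞)^N : Σ_{i=1}^N (n−m−i+1) z_i ≤ c₀ (x+β)} satisfies ∫_R q̂(z) dz = 1−λ, and R is a highest-predictive-density region: there exists k > 0 such that R = {z ∈ (0,∞)^N : q̂(z) ≥ k}. -/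
open MeasureTheory Real

open Set in
/-- The sum of `k + 1` positive coordinates pushes Lebesgue measure on the positive orthant
forward to the measure with density `w ^ k / k!` on `(0, ∞)`. -/
theorem lintegral_posOrthant_comp_sum (k : ℕ) (F : ℝ → ENNReal) (hF : Measurable F) :
    ∫⁻ z : Fin (k + 1) → ℝ, (∏ i, (Ioi (0 : ℝ)).indicator 1 (z i)) * F (∑ i, z i) =
      ∫⁻ w, (Ioi (0 : ℝ)).indicator (fun w => ENNReal.ofReal (w ^ k / k.factorial)) w * F w := by
  have hI : Measurable ((Ioi (0 : ℝ)).indicator (1 : ℝ → ENNReal)) :=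
    measurable_one.indicator measurableSet_Ioi
  induction k generalizing F with
  | zero =>
    refine ((volume_preserving_funUnique (Fin 1) ℝ).symm.lintegral_comp_emb
      (MeasurableEquiv.measurableEmbedding _) _).symm.trans ?_
    refine lintegral_congr fun w => ?_
    simp [MeasurableEquiv.funUnique, indicator]
  | succ k ih =>
    have hG : Measurable
        ((Ioi (0 : ℝ)).indicator (fun w => ENNReal.ofReal (w ^ k / k.factorial))) :=
      Measurable.indicator (by fun_prop) measurableSet_Ioi
    rw [← (volume_preserving_piFinSuccAbove (fun _ : Fin (k + 2) => ℝ) 0).symm.lintegral_comp_emb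
      (MeasurableEquiv.measurableEmbedding _), Measure.volume_eq_prod, lintegral_prod]
    · calc
        _ = ∫⁻ y, (Ioi (0 : ℝ)).indicator 1 y *
            ∫⁻ z : Fin (k + 1) → ℝ, (∏ i, (Ioi (0 : ℝ)).indicator 1 (z i)) *
              F (y + ∑ i, z i) := by
          refine lintegral_congr fun y => ?_
          rw [← lintegral_const_mul]
          · refine lintegral_congr fun z => ?_
            simp [MeasurableEquiv.piFinSuccAbove, Fin.prod_univ_succ, Fin.sum_univ_succ, mul_assoc]
          · fun_prop
        _ = ∫⁻ y, ∫⁻ w, (Ioi (0 : ℝ)).indicator 1 y *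
            ((Ioi (0 : ℝ)).indicator (fun w => ENNReal.ofReal (w ^ k / k.factorial)) w *
              F (y + w)) := by
          refine lintegral_congr fun y => ?_
          rw [ih (fun s => F (y + s)) (by fun_prop), lintegral_const_mul _ (by fun_prop)]
        _ = ∫⁻ w, ∫⁻ y, (Ioi (0 : ℝ)).indicator 1 y *
            ((Ioi (0 : ℝ)).indicator (fun w => ENNReal.ofReal (w ^ k / k.factorial)) w *
              F (y + w)) := lintegral_lintegral_swap (by fun_prop)
        _ = ∫⁻ w, ∫⁻ s, (Ioi (0 : ℝ)).indicator 1 (s - w) *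
            ((Ioi (0 : ℝ)).indicator (fun w => ENNReal.ofReal (w ^ k / k.factorial)) w *
              F s) := by
          refine lintegral_congr fun w => ?_
          rw [← lintegral_sub_right_eq_self _ w]
          simp
        _ = ∫⁻ s, ∫⁻ w, (Ioi (0 : ℝ)).indicator 1 (s - w) *
            ((Ioi (0 : ℝ)).indicator (fun w => ENNReal.ofReal (w ^ k / k.factorial)) w *
              F s) := lintegral_lintegral_swap (by fun_prop)
        _ = _ := by
          refine lintegral_congr fun s => ?_
          simp_rw [← mul_assoc]
          rw [lintegral_mul_const _ (by fun_prop)]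
          congr 1
          have hprod : ∀ w : ℝ, (Ioi (0 : ℝ)).indicator (1 : ℝ → ENNReal) (s - w) *
              (Ioi (0 : ℝ)).indicator (fun w => ENNReal.ofReal (w ^ k / k.factorial)) w =
              (Ioo 0 s).indicator (fun w => ENNReal.ofReal (w ^ k / k.factorial)) w := by
            intro w
            by_cases h₁ : 0 < w <;> by_cases h₂ : w < s <;> simp [indicator, h₁, h₂]
          simp_rw [hprod]
          rw [lintegral_indicator measurableSet_Ioo]
          by_cases hs : 0 < s
          · rw [indicator_of_mem (mem_Ioi.2 hs), setLIntegral_congr Ioo_ae_eq_Ioc,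
              ← ofReal_integral_eq_lintegral_ofReal]
            · rw [← intervalIntegral.integral_of_le hs.le, intervalIntegral.integral_div,
                integral_pow, Nat.factorial_succ]
              congr 1
              push_cast
              field_simp
              simp
            · exact (Continuous.integrableOn_Icc (by fun_prop)).mono_set Ioc_subset_Icc_self
            · filter_upwards [ae_restrict_mem measurableSet_Ioc] with w hw
              have := hw.1.le
              positivity
          · simp [hs]
    · fun_prop

/-- Rescaling the coordinates by positive factors in an integral over `Fin N → ℝ`. -/
theorem lintegral_comp_pi_mul {N : ℕ} (h : Fin N → ℝ) (hh : ∀ i, 0 < h i)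
    (f : (Fin N → ℝ) → ENNReal) (hf : Measurable f) :
    ENNReal.ofReal (∏ i, h i) * ∫⁻ z : Fin N → ℝ, f (fun i => h i * z i) = ∫⁻ z, f z := by
  have hdet : (Matrix.diagonal h).det ≠ 0 := by
    rw [Matrix.det_diagonal]
    exact Finset.prod_ne_zero_iff.2 fun i _ => (hh i).ne'
  conv_rhs => rw [← Real.smul_map_diagonal_volume_pi hdet]
  rw [lintegral_smul_measure, lintegral_map hf (by fun_prop), Matrix.det_diagonal,
    abs_of_pos (Finset.prod_pos fun i _ => hh i), smul_eq_mul]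
  congr 2
  funext z
  congr 1
  funext i
  simp [Matrix.mulVec_diagonal]

theorem mvParetoPDF_of_pos {N : ℕ} {a : ℝ} {h z : Fin N → ℝ} (hz : ∀ i, 0 < z i) :
    mvParetoPDF a h z = (Real.Gamma (a + N) / Real.Gamma a) * (∏ i, h i) *
      (1 + ∑ i, h i * z i) ^ (-(a + (N : ℝ))) :=
  if_pos hz

theorem mvParetoPDF_nonneg {N : ℕ} {a : ℝ} (ha : 0 < a) {h : Fin N → ℝ} (hh : ∀ i, 0 < h i)
    (z : Fin N → ℝ) : 0 ≤ mvParetoPDF a h z := by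
  unfold mvParetoPDF
  split_ifs with hz
  · have hΓ := Real.Gamma_pos_of_pos ha
    have hΓN : 0 < Real.Gamma (a + N) := Real.Gamma_pos_of_pos (by positivity)
    have hprod : 0 < ∏ i, h i := Finset.prod_pos fun i _ => hh i
    have hsum : 0 ≤ ∑ i, h i * z i := Finset.sum_nonneg fun i _ => (mul_pos (hh i) (hz i)).le
    positivity
  · exact le_rfl

theorem measurableSet_posOrthant (N : ℕ) : MeasurableSet {z : Fin N → ℝ | ∀ i, 0 < z i} := by
  measurability

theorem measurable_mvParetoPDF {N : ℕ} (a : ℝ) (h : Fin N → ℝ) :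
    Measurable (mvParetoPDF a h) :=
  Measurable.ite (measurableSet_posOrthant N) (by fun_prop) measurable_const

theorem betaTypeIIPDF_nonneg {b a : ℝ} (hb : 0 < b) (ha : 0 < a) (w : ℝ) :
    0 ≤ betaTypeIIPDF b a w := by
  unfold betaTypeIIPDF
  split_ifs with hw
  · have hΓa := Real.Gamma_pos_of_pos ha
    have hΓb := Real.Gamma_pos_of_pos hb
    have hΓ := Real.Gamma_pos_of_pos (add_pos hb ha)
    positivity
  · exact le_rfl

theorem measurable_betaTypeIIPDF (b a : ℝ) : Measurable (betaTypeIIPDF b a) :=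
  Measurable.ite measurableSet_Ioi (by fun_prop) measurable_const

/-- If `Z` is multivariate Pareto type II, then `∑ h i * Z i` has the `B2(N, a)` distribution. -/
theorem setIntegral_mvParetoPDF {N : ℕ} (hN : 1 ≤ N) {a : ℝ} (ha : 0 < a) {h : Fin N → ℝ}
    (hh : ∀ i, 0 < h i) (c : ℝ) :
    ∫ z in {z : Fin N → ℝ | (∀ i, 0 < z i) ∧ ∑ i, h i * z i ≤ c}, mvParetoPDF a h z =
      ∫ w in Set.Ioc 0 c, betaTypeIIPDF N a w := by
  obtain ⟨k, rfl⟩ : ∃ k, N = k + 1 := ⟨N - 1, by omega⟩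
  have hΓ : 0 < Real.Gamma a := Real.Gamma_pos_of_pos ha
  have hprod : 0 < ∏ i, h i := Finset.prod_pos fun i _ => hh i
  set F : ℝ → ENNReal := (Set.Iic c).indicator fun s => ENNReal.ofReal
    (Real.Gamma (a + (k + 1 : ℕ)) / Real.Gamma a * (1 + s) ^ (-(a + ((k + 1 : ℕ) : ℝ)))) with hFdef
  have hF : Measurable F := Measurable.indicator (by fun_prop) measurableSet_Iic
  have hI : Measurable ((Set.Ioi (0 : ℝ)).indicator (1 : ℝ → ENNReal)) :=
    measurable_one.indicator measurableSet_Ioi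
  have hR : MeasurableSet {z : Fin (k + 1) → ℝ | (∀ i, 0 < z i) ∧ ∑ i, h i * z i ≤ c} :=
    have hle : MeasurableSet {z : Fin (k + 1) → ℝ | ∑ i, h i * z i ≤ c} :=
      measurableSet_le (by fun_prop) measurable_const
    (measurableSet_posOrthant _).inter hle
  rw [integral_eq_lintegral_of_nonneg_ae (ae_of_all _ (mvParetoPDF_nonneg ha hh))
      (measurable_mvParetoPDF a h).aestronglyMeasurable,
    integral_eq_lintegral_of_nonneg_ae
      (ae_of_all _ (betaTypeIIPDF_nonneg (by positivity) ha))
      (measurable_betaTypeIIPDF _ a).aestronglyMeasurable,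
    ← lintegral_indicator hR, ← lintegral_indicator measurableSet_Ioc]
  congr 1
  calc
    _ = ENNReal.ofReal (∏ i, h i) * ∫⁻ z : Fin (k + 1) → ℝ,
        (∏ i, (Set.Ioi (0 : ℝ)).indicator 1 (h i * z i)) * F (∑ i, h i * z i) := by
      have hmeas : Measurable fun z : Fin (k + 1) → ℝ =>
          (∏ i, (Set.Ioi (0 : ℝ)).indicator (1 : ℝ → ENNReal) (h i * z i)) *
            F (∑ i, h i * z i) := by
        fun_prop
      rw [← lintegral_const_mul _ hmeas]
      refine lintegral_congr fun z => ?_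
      by_cases hz : ∀ i, 0 < z i
      · have hone : ∏ i, (Set.Ioi (0 : ℝ)).indicator (1 : ℝ → ENNReal) (h i * z i) = 1 :=
          Finset.prod_eq_one fun i _ =>
            Set.indicator_of_mem (Set.mem_Ioi.2 (mul_pos (hh i) (hz i))) _
        rw [hone, one_mul]
        by_cases hc : ∑ i, h i * z i ≤ c
        · rw [Set.indicator_of_mem (by exact ⟨hz, hc⟩), hFdef,
            Set.indicator_of_mem (Set.mem_Iic.2 hc), mvParetoPDF_of_pos hz,
            ← ENNReal.ofReal_mul hprod.le]
          congr 1
          ring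
        · rw [Set.indicator_of_notMem (fun hmem => hc hmem.2), hFdef,
            Set.indicator_of_notMem (by simpa using hc), mul_zero]
      · rw [Set.indicator_of_notMem (fun hmem => hz hmem.1)]
        obtain ⟨i, hi⟩ := not_forall.1 hz
        have hzero : ∏ i, (Set.Ioi (0 : ℝ)).indicator (1 : ℝ → ENNReal) (h i * z i) = 0 :=
          Finset.prod_eq_zero (Finset.mem_univ i) <| Set.indicator_of_notMem
            (fun hmem => hi ((mul_pos_iff_of_pos_left (hh i)).1 hmem)) _
        rw [hzero, zero_mul, mul_zero]
    _ = ∫⁻ z : Fin (k + 1) → ℝ,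
        (∏ i, (Set.Ioi (0 : ℝ)).indicator 1 (z i)) * F (∑ i, z i) :=
      lintegral_comp_pi_mul h hh
        (fun z => (∏ i, (Set.Ioi (0 : ℝ)).indicator 1 (z i)) * F (∑ i, z i)) (by fun_prop)
    _ = ∫⁻ w, (Set.Ioi (0 : ℝ)).indicator
        (fun w => ENNReal.ofReal (w ^ k / k.factorial)) w * F w :=
      lintegral_posOrthant_comp_sum k F hF
    _ = _ := by
      refine lintegral_congr fun w => ?_
      by_cases hw : 0 < w
      · by_cases hc : w ≤ c
        · rw [Set.indicator_of_mem (Set.mem_Ioi.2 hw), hFdef,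
            Set.indicator_of_mem (Set.mem_Iic.2 hc), Set.indicator_of_mem (Set.mem_Ioc.2 ⟨hw, hc⟩),
            ← ENNReal.ofReal_mul (by positivity), betaTypeIIPDF, if_pos hw,
            Real.rpow_neg (by positivity), add_comm a]
          push_cast
          rw [Real.Gamma_nat_eq_factorial, add_sub_cancel_right, Real.rpow_natCast]
          congr 1
          field_simp
        · simp [hFdef, hc]
      · simp [hw]

/-- On the positive orthant, the Pareto density is at least its value at `∑ h i * z i = c`
exactly when `∑ h i * z i ≤ c`. -/
theorem setOf_le_mvParetoPDF {N : ℕ} {a : ℝ} (ha : 0 < a) {h : Fin N → ℝ} (hh : ∀ i, 0 < h i)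
    {c : ℝ} (hc : 0 < c) :
    ∃ k : ℝ, 0 < k ∧ {z : Fin N → ℝ | (∀ i, 0 < z i) ∧ ∑ i, h i * z i ≤ c} =
      {z | k ≤ mvParetoPDF a h z} := by
  have hA : 0 < Real.Gamma (a + N) / Real.Gamma a * ∏ i, h i :=
    mul_pos (div_pos (Real.Gamma_pos_of_pos (by positivity)) (Real.Gamma_pos_of_pos ha))
      (Finset.prod_pos fun i _ => hh i)
  have hk : 0 < Real.Gamma (a + N) / Real.Gamma a * (∏ i, h i) * (1 + c) ^ (-(a + (N : ℝ))) :=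
    mul_pos hA (by positivity)
  refine ⟨_, hk, Set.ext fun z => ?_⟩
  by_cases hz : ∀ i, 0 < z i
  · have hsum : 0 ≤ ∑ i, h i * z i := Finset.sum_nonneg fun i _ => (mul_pos (hh i) (hz i)).le
    have hexp : -(a + (N : ℝ)) < 0 := neg_lt_zero.2 (by positivity)
    simp only [Set.mem_ofPred_eq]
    rw [mvParetoPDF_of_pos hz, mul_le_mul_iff_right₀ hA,
      Real.rpow_le_rpow_iff_of_neg (by positivity) (by positivity) hexp, add_le_add_iff_left]
    exact and_iff_right hz
  · simp only [Set.mem_ofPred_eq]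
    rw [mvParetoPDF, if_neg hz]
    exact iff_of_false (fun hmem => hz hmem.1) hk.not_ge

/-- HPD prediction region (Theorem 3.7): with `q̂` the multivariate Pareto type II
predictive density with shape `m+α` and `h_i = (n-m-i+1)/(x+β)`, and `c₀` the
`(1-λ)`-quantile of `B2(N, m+α)`, the region
`R = {z ∈ (0,∞)^N : Σ (n-m-i+1) z_i ≤ c₀ (x+β)}` has predictive probability `1-λ`
and is a highest-predictive-density region: `R = {z ∈ (0,∞)^N : q̂(z) ≥ k}` for some `k > 0`. -/
theorem hpd_region_spacings
    (n m N : ℕ) (hm : 1 ≤ m) (hmn : m < n) (hN : 1 ≤ N) (hNnm : N ≤ n - m)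
    (α β : ℝ) (hα : 0 ≤ α) (hβ : 0 ≤ β) (hmα : 0 < (m : ℝ) + α)
    (x : ℝ) (hx : 0 < x) (hxβ : 0 < x + β)
    (lam : ℝ) (hlam : lam ∈ Set.Ioo (0 : ℝ) 1)
    (c₀ : ℝ) (hc₀ : 0 < c₀)
    (hquantile : (∫ w in Set.Ioc (0 : ℝ) c₀, betaTypeIIPDF (N : ℝ) ((m : ℝ) + α) w) = 1 - lam)
    (R : Set (Fin N → ℝ))
    (hR : R = {z : Fin N → ℝ | (∀ i, 0 < z i) ∧
      ∑ i : Fin N, ((n - m - i.val : ℕ) : ℝ) * z i ≤ c₀ * (x + β)}) :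
    (∫ z in R,
        mvParetoPDF ((m : ℝ) + α) (fun i : Fin N => ((n - m - i.val : ℕ) : ℝ) / (x + β)) z) =
        1 - lam ∧
      ∃ k : ℝ, 0 < k ∧
        R = {z : Fin N → ℝ |
          k ≤ mvParetoPDF ((m : ℝ) + α)
                (fun i : Fin N => ((n - m - i.val : ℕ) : ℝ) / (x + β)) z} := by
  have hh : ∀ i : Fin N, 0 < ((n - m - i.val : ℕ) : ℝ) / (x + β) := fun i =>
    div_pos (Nat.cast_pos.2 (by omega)) hxβ
  have hRh : R = {z : Fin N → ℝ | (∀ i, 0 < z i) ∧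
      ∑ i : Fin N, ((n - m - i.val : ℕ) : ℝ) / (x + β) * z i ≤ c₀} := by
    simp only [hR, div_mul_eq_mul_div, ← Finset.sum_div, div_le_iff₀ hxβ]
  rw [hRh]
  exact ⟨(setIntegral_mvParetoPDF hN hmα hh c₀).trans hquantile,
    setOf_le_mvParetoPDF hmα hh hc₀⟩
end

section
/- Let p₁ be a probability density on (0,∞) and q₁ a probability density on (0,∞)^{d₂}, and for σ > 0 set p_σ(x) = (1/σ)p₁(x/σ) and q_σ(y') = σ^{−d₂} q₁(y'₁/σ,…,y'_{d₂}/σ). For the prior density π₀(σ) = 1/σ on (0,∞), the posterior density given x > 0 is π(σ|x) = (x/σ²)p₁(x/σ), and the Bayes predictive density satisfies, for all x > 0 and y' ∈ (0,∞)^{d₂}: ∫₀^∞ q_σ(y') π(σ|x) dσ = x^{−d₂} h(y'/x), where h(r) = ∫₀^∞ u^{d₂} q₁(r₁u,…,r_{d₂}u) p₁(u) du. Moreover, if X has density p_σ and Y' has density q_σ with X and Y' independent, then for every σ > 0 the random vector R = Y'/X = (Y'₁/X,…,Y'_{d₂}/X) has density h, which is free of σ. -/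
open MeasureTheory ProbabilityTheory Real

/-- `h(r) = ∫₀^∞ u^{d₂} q₁(r₁u,…,r_{d₂}u) p₁(u) du`, the density of the ratio
`R = Y'/X` in the scale family model. -/
noncomputable def ratioPDF (d₂ : ℕ) (p₁ : ℝ → ℝ) (q₁ : (Fin d₂ → ℝ) → ℝ)
    (r : Fin d₂ → ℝ) : ℝ :=
  ∫ u in Set.Ioi (0 : ℝ), u ^ d₂ * q₁ (fun i => r i * u) * p₁ u

open Module in
theorem lintegral_eq_abs_pow_finrank_mul_lintegral_comp_smul {E : Type*} [NormedAddCommGroup E]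
    [NormedSpace ℝ E] [MeasurableSpace E] [BorelSpace E] [FiniteDimensional ℝ E]
    (μ : Measure E) [μ.IsAddHaarMeasure] {f : E → ENNReal} (hf : Measurable f)
    {c : ℝ} (hc : c ≠ 0) :
    ∫⁻ x, f x ∂μ = ENNReal.ofReal |c ^ finrank ℝ E| * ∫⁻ x, f (c • x) ∂μ := by
  have hpow : 0 < |c ^ finrank ℝ E| := by positivity
  rw [← lintegral_map hf (measurable_const_smul c), Measure.map_addHaar_smul μ hc,
    lintegral_smul_measure, smul_eq_mul, ← mul_assoc, ← ENNReal.ofReal_mul hpow.le,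
    abs_inv, mul_inv_cancel₀ hpow.ne', ENNReal.ofReal_one, one_mul]

open Module in
/-- The law of the ratio `Y / X` of independent variables with densities `g` and `f`. -/
theorem map_inv_smul_prod_withDensity {E : Type*} [NormedAddCommGroup E]
    [NormedSpace ℝ E] [MeasurableSpace E] [BorelSpace E] [FiniteDimensional ℝ E]
    (μ : Measure E) [μ.IsAddHaarMeasure] {f : ℝ → ENNReal} (hf : Measurable f)
    {g : E → ENNReal} (hg : Measurable g) :
    Measure.map (fun z : ℝ × E => z.1⁻¹ • z.2)
        ((volume.withDensity f).prod (μ.withDensity g)) =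
      μ.withDensity
        (fun r => ∫⁻ x, ENNReal.ofReal |x ^ finrank ℝ E| * (f x * g (x • r))) := by
  refine Measure.ext_of_lintegral _ fun φ hφ => ?_
  have hF : Measurable fun z : E × ℝ =>
      ENNReal.ofReal |z.2 ^ finrank ℝ E| * (f z.2 * g (z.2 • z.1)) := by fun_prop
  rw [lintegral_map hφ (by fun_prop), prod_withDensity hf hg,
    lintegral_withDensity_eq_lintegral_mul _ (by fun_prop) (by fun_prop),
    lintegral_prod _ (by fun_prop),
    lintegral_withDensity_eq_lintegral_mul _ hF.lintegral_prod_right' hφ]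
  simp only [Pi.mul_apply]
  have hswap : ∀ r, (∫⁻ x, ENNReal.ofReal |x ^ finrank ℝ E| * (f x * g (x • r))) * φ r =
      ∫⁻ x, ENNReal.ofReal |x ^ finrank ℝ E| * (f x * g (x • r)) * φ r :=
    fun r => (lintegral_mul_const _ (by fun_prop)).symm
  simp_rw [hswap]
  conv_rhs => rw [lintegral_lintegral_swap (by fun_prop)]
  refine lintegral_congr_ae ?_
  filter_upwards [Measure.ae_ne volume (0 : ℝ)] with x hx
  rw [lintegral_eq_abs_pow_finrank_mul_lintegral_comp_smul μ (by fun_prop) hx,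
    ← lintegral_const_mul _ (by fun_prop)]
  simp only [inv_smul_smul₀ hx, mul_assoc]

theorem setIntegral_Ioi_eq_setIntegral_Ioi_comp_div {E : Type*} [NormedAddCommGroup E]
    [NormedSpace ℝ E] (f : ℝ → E) {x : ℝ} (hx : 0 < x) :
    ∫ s in Set.Ioi (0 : ℝ), f s = ∫ u in Set.Ioi (0 : ℝ), (x / u ^ 2) • f (x / u) := by
  have himage : (fun u : ℝ => x / u) '' Set.Ioi 0 = Set.Ioi 0 := by
    ext s
    simp only [Set.mem_image, Set.mem_Ioi]
    exact ⟨fun ⟨u, hu, hs⟩ => hs ▸ div_pos hx hu,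
      fun hs => ⟨x / s, div_pos hx hs, div_div_cancel₀ hx.ne'⟩⟩
  have hderiv : ∀ u ∈ Set.Ioi (0 : ℝ),
      HasDerivWithinAt (fun u : ℝ => x / u) (-(x / u ^ 2)) (Set.Ioi 0) u := fun u hu => by
    convert! ((hasDerivAt_inv (ne_of_gt hu)).const_mul x).hasDerivWithinAt using 1
    ring
  have hinj : Set.InjOn (fun u : ℝ => x / u) (Set.Ioi 0) := fun u hu v hv huv => by
    have hu' : u ≠ 0 := ne_of_gt hu
    have hv' : v ≠ 0 := ne_of_gt hv
    have h : x / u = x / v := huv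
    rw [div_eq_div_iff hu' hv'] at h
    exact (mul_left_cancel₀ hx.ne' h).symm
  conv_lhs => rw [← himage]
  rw [integral_image_eq_integral_abs_deriv_smul measurableSet_Ioi hderiv hinj]
  refine setIntegral_congr_fun measurableSet_Ioi fun u hu => ?_
  have hu' : (0 : ℝ) < u := hu
  simp only [abs_neg, abs_of_pos (div_pos hx (pow_pos hu' 2))]

theorem integral_scale_mul_posterior_eq_ratioPDF (d : ℕ) (p : ℝ → ℝ) (q : (Fin d → ℝ) → ℝ)
    {x : ℝ} (hx : 0 < x) (y : Fin d → ℝ) :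
    (∫ σ in Set.Ioi (0 : ℝ),
        ((σ ^ d)⁻¹ * q (fun i => y i / σ)) * (x / σ ^ 2 * p (x / σ))) =
      (x ^ d)⁻¹ * ratioPDF d p q (fun i => y i / x) := by
  rw [setIntegral_Ioi_eq_setIntegral_Ioi_comp_div _ hx, ratioPDF, ← integral_const_mul]
  refine setIntegral_congr_fun measurableSet_Ioi fun u hu => ?_
  have hu' : u ≠ 0 := ne_of_gt hu
  have hx' := hx.ne'
  have hy : (fun i => y i / (x / u)) = fun i => y i / x * u := by
    funext i
    field_simp
  simp only [hy, div_div_cancel₀ hx', smul_eq_mul, div_pow]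
  field_simp

/-- In the scale model, the density of the ratio does not depend on the scale. -/
theorem lintegral_scale_densities_eq (d : ℕ) {p : ℝ → ℝ} {q : (Fin d → ℝ) → ℝ}
    (hp : Measurable p) (hp_nonneg : ∀ x, 0 ≤ p x) (hp_supp : ∀ x ≤ 0, p x = 0)
    (hq : Measurable q) {σ : ℝ} (hσ : 0 < σ) (r : Fin d → ℝ) :
    ∫⁻ x, ENNReal.ofReal |x ^ d| * (ENNReal.ofReal (1 / σ * p (x / σ)) *
        ENNReal.ofReal ((σ ^ d)⁻¹ * q (fun i => (x • r) i / σ))) =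
      ∫⁻ u in Set.Ioi (0 : ℝ), ENNReal.ofReal (u ^ d * q (fun i => r i * u) * p u) := by
  rw [lintegral_eq_abs_pow_finrank_mul_lintegral_comp_smul volume (by fun_prop) hσ.ne',
    ← lintegral_const_mul _ (by fun_prop), ← lintegral_indicator measurableSet_Ioi]
  refine lintegral_congr fun u => ?_
  have hσ' := hσ.ne'
  have hr : (fun i => ((σ • u) • r) i / σ) = fun i => r i * u := by
    funext i
    simp only [Pi.smul_apply, smul_eq_mul]
    field_simp
  have hu : (σ • u) / σ = u := by
    simp only [smul_eq_mul]
    field_simp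
  rw [hr, hu]
  rcases le_or_gt u 0 with hu0 | hu0
  · simp [hp_supp u hu0, Set.indicator_of_notMem (Set.notMem_Ioi.2 hu0)]
  · have hpu : 0 ≤ 1 / σ * p u := mul_nonneg (by positivity) (hp_nonneg u)
    rw [Set.indicator_of_mem (Set.mem_Ioi.2 hu0), ← ENNReal.ofReal_mul hpu,
      ← ENNReal.ofReal_mul (abs_nonneg _), ← ENNReal.ofReal_mul (abs_nonneg _)]
    congr 1
    rw [smul_eq_mul, Module.finrank_self, abs_of_pos (by positivity),
      abs_of_pos (by positivity), mul_pow]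
    generalize q (fun i => r i * u) = w
    field_simp

theorem ofReal_ratioPDF {d : ℕ} {p : ℝ → ℝ} {q : (Fin d → ℝ) → ℝ}
    (hp : Measurable p) (hp_nonneg : ∀ x, 0 ≤ p x)
    (hq : Measurable q) (hq_nonneg : ∀ y, 0 ≤ q y) {r : Fin d → ℝ}
    (hr : ∫⁻ u in Set.Ioi (0 : ℝ),
      ENNReal.ofReal (u ^ d * q (fun i => r i * u) * p u) ≠ ⊤) :
    ENNReal.ofReal (ratioPDF d p q r) =
      ∫⁻ u in Set.Ioi (0 : ℝ), ENNReal.ofReal (u ^ d * q (fun i => r i * u) * p u) := by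
  rw [ratioPDF, integral_eq_lintegral_of_nonneg_ae _
    (by fun_prop : Measurable _).aestronglyMeasurable, ENNReal.ofReal_toReal hr]
  filter_upwards [ae_restrict_mem measurableSet_Ioi] with u hu
  exact mul_nonneg (mul_nonneg (pow_nonneg (le_of_lt hu) d) (hq_nonneg _)) (hp_nonneg u)

/-- Scale family model: `p_σ(x) = (1/σ)p₁(x/σ)` on `(0,∞)`,
`q_σ(y') = σ^{-d₂} q₁(y'/σ)` on `(0,∞)^{d₂}`, prior `π₀(σ) = 1/σ`, so the posterior given
`x > 0` is `π(σ|x) = (x/σ²)p₁(x/σ)`. Then (a) the Bayes predictive density satisfies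
`∫₀^∞ q_σ(y') π(σ|x) dσ = x^{-d₂} h(y'/x)` with `h(r) = ∫₀^∞ u^{d₂} q₁(ru) p₁(u) du`;
and (b) if `X ~ p_σ` and `Y' ~ q_σ` are independent, then `R = Y'/X` has density `h`,
which is free of `σ`. -/
theorem scale_model_predictive_density_and_ratio_density
    (d₂ : ℕ) (hd₂ : 1 ≤ d₂)
    (p₁ : ℝ → ℝ) (q₁ : (Fin d₂ → ℝ) → ℝ)
    (hp₁meas : Measurable p₁) (hp₁nonneg : ∀ x, 0 ≤ p₁ x)
    (hp₁supp : ∀ x : ℝ, x ≤ 0 → p₁ x = 0) (hp₁int : (∫ x, p₁ x) = 1)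
    (hq₁meas : Measurable q₁) (hq₁nonneg : ∀ y, 0 ≤ q₁ y)
    (hq₁supp : ∀ y : Fin d₂ → ℝ, ¬(∀ i, 0 < y i) → q₁ y = 0) (hq₁int : (∫ y, q₁ y) = 1) :
    (∀ x : ℝ, 0 < x → ∀ y' : Fin d₂ → ℝ,
      (∫ σ in Set.Ioi (0 : ℝ),
          ((σ ^ d₂)⁻¹ * q₁ (fun i => y' i / σ)) * (x / σ ^ 2 * p₁ (x / σ))) =
        ((x : ℝ) ^ d₂)⁻¹ * ratioPDF d₂ p₁ q₁ (fun i => y' i / x)) ∧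
    (∀ (Ω : Type) (_ : MeasurableSpace Ω) (μ : Measure Ω), IsProbabilityMeasure μ →
      ∀ (σ : ℝ), 0 < σ →
      ∀ (X : Ω → ℝ) (Y' : Ω → (Fin d₂ → ℝ)), Measurable X → Measurable Y' →
      Measure.map X μ =
        volume.withDensity (fun x => ENNReal.ofReal (1 / σ * p₁ (x / σ))) →
      Measure.map Y' μ =
        volume.withDensity (fun y => ENNReal.ofReal ((σ ^ d₂)⁻¹ * q₁ (fun i => y i / σ))) →
      IndepFun X Y' μ →
      Measure.map (fun ω => (fun i => Y' ω i / X ω : Fin d₂ → ℝ)) μ =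
        volume.withDensity (fun r => ENNReal.ofReal (ratioPDF d₂ p₁ q₁ r))) := by
  refine ⟨fun x hx y => integral_scale_mul_posterior_eq_ratioPDF d₂ p₁ q₁ hx y, ?_⟩
  intro Ω _ μ _ σ hσ X Y hX hY hXlaw hYlaw hXY
  have hlaw : Measure.map (fun ω => (fun i => Y ω i / X ω : Fin d₂ → ℝ)) μ =
      volume.withDensity (fun r => ∫⁻ u in Set.Ioi (0 : ℝ),
        ENNReal.ofReal (u ^ d₂ * q₁ (fun i => r i * u) * p₁ u)) := by
    have hcomp : (fun ω => (fun i => Y ω i / X ω : Fin d₂ → ℝ)) =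
        (fun z : ℝ × (Fin d₂ → ℝ) => z.1⁻¹ • z.2) ∘ fun ω => (X ω, Y ω) := by
      funext ω i
      simp [div_eq_inv_mul]
    rw [hcomp, ← Measure.map_map (by fun_prop) (by fun_prop),
      (indepFun_iff_map_prod_eq_prod_map_map hX.aemeasurable hY.aemeasurable).1 hXY,
      hXlaw, hYlaw, map_inv_smul_prod_withDensity volume (by fun_prop) (by fun_prop)]
    simp_rw [Module.finrank_fin_fun,
      lintegral_scale_densities_eq d₂ hp₁meas hp₁nonneg hp₁supp hq₁meas hσ]
  have hmeas : Measurable fun r : Fin d₂ → ℝ => ∫⁻ u in Set.Ioi (0 : ℝ),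
      ENNReal.ofReal (u ^ d₂ * q₁ (fun i => r i * u) * p₁ u) := by
    refine Measurable.lintegral_prod_right' (f := fun z : (Fin d₂ → ℝ) × ℝ =>
      ENNReal.ofReal (z.2 ^ d₂ * q₁ (fun i => z.1 i * z.2) * p₁ z.2)) ?_
    fun_prop
  have hfin : ∫⁻ r : Fin d₂ → ℝ, ∫⁻ u in Set.Ioi (0 : ℝ),
      ENNReal.ofReal (u ^ d₂ * q₁ (fun i => r i * u) * p₁ u) ≠ ⊤ := by
    rw [← setLIntegral_univ, ← withDensity_apply _ MeasurableSet.univ, ← hlaw]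
    exact measure_ne_top _ _
  rw [hlaw]
  refine withDensity_congr_ae ?_
  filter_upwards [ae_lt_top hmeas hfin] with r hr
  exact (ofReal_ratioPDF hp₁meas hp₁nonneg hq₁meas hq₁nonneg hr.ne).symm
end
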